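/- Let k be an algebraically closed field and a, b ∈ k with not both a = 1 and b = -1. Then for every n ≥ 0, the image in C(a,b,1) of the n-th homogeneous component of the free algebra k⟨x,z⟩ (the k-linear span of all words of length n in x and z) under the quotient map is a k-subspace of dimension n + 1. (Equivalently, the Hilbert series of C(a,b,1) is (1-t)^{-2}.) -/

import Mathlib

noncomputable section

open FreeAlgebra

/-- The generator `x` of the free algebra `k⟨x,z⟩`. -/
def Xf (k : Type*) [Field k] : FreeAlgebra k (Fin 2) := FreeAlgebra.ι k 0

/-- The generator `z` of the free algebra `k⟨x,z⟩`. -/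
def Zf (k : Type*) [Field k] : FreeAlgebra k (Fin 2) := FreeAlgebra.ι k 1

/-- The relation defining `C(a,b,c)`: `zx = a·x² + b·xz + c·z²`. -/
def Crel (k : Type*) [Field k] (a b c : k) :
    FreeAlgebra k (Fin 2) → FreeAlgebra k (Fin 2) → Prop := fun m n =>
  m = Zf k * Xf k ∧ n = a • (Xf k) ^ 2 + b • (Xf k * Zf k) + c • (Zf k) ^ 2

/-- The algebra `C(a,b,c) = k⟨x,z⟩/⟨zx - a·x² - b·xz - c·z²⟩`. -/
abbrev Calg (k : Type*) [Field k] (a b c : k) := RingQuot (Crel k a b c)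

/-- The `n`-th homogeneous component of the free algebra `k⟨x,z⟩`: the `k`-linear span
of all words of length `n` in the generators. -/
def degComp (k : Type*) [Field k] (n : ℕ) : Submodule k (FreeAlgebra k (Fin 2)) :=
  Submodule.span k
    { w | ∃ l : List (Fin 2), l.length = n ∧ w = (l.map (FreeAlgebra.ι k)).prod }

/-- The coefficients of the commutation formula `w ^ j * x = q ^ j * x * w ^ j + r_j * w ^ (j + 1)`. -/
def commCoeff {k : Type*} [Field k] (q r : k) : ℕ → k
  | 0 => 0
  | j + 1 => q * commCoeff q r j + r

theorem pow_mul_of_mul_eq {k A : Type*} [Field k] [Ring A] [Algebra k A] {q r : k} {x w : A}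
    (h : w * x = q • (x * w) + r • w ^ 2) (j : ℕ) :
    w ^ j * x = q ^ j • (x * w ^ j) + commCoeff q r j • w ^ (j + 1) := by
  induction j with
  | zero => simp [commCoeff]
  | succ j ih =>
    rw [pow_succ, mul_assoc, h, mul_add, mul_smul_comm, mul_smul_comm, ← mul_assoc, ih, add_mul,
      smul_mul_assoc, smul_mul_assoc, mul_assoc, ← pow_succ, ← pow_succ, ← pow_add, commCoeff]
    module

/-- Right multiplication by `x` in the basis `x ^ i * w ^ j`. -/
def rightX {k : Type*} [Field k] (q r : k) : Module.End k (ℕ × ℕ →₀ k) :=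
  Finsupp.linearCombination k fun p =>
    q ^ p.2 • Finsupp.single (p.1 + 1, p.2) 1 + commCoeff q r p.2 • Finsupp.single (p.1, p.2 + 1) 1

/-- Right multiplication by `w` in the basis `x ^ i * w ^ j`. -/
def rightW (k : Type*) [Field k] : Module.End k (ℕ × ℕ →₀ k) :=
  Finsupp.linearCombination k fun p => Finsupp.single (p.1, p.2 + 1) 1

theorem rightX_single {k : Type*} [Field k] (q r : k) (i j : ℕ) :
    rightX q r (Finsupp.single (i, j) 1) =
      q ^ j • Finsupp.single (i + 1, j) 1 + commCoeff q r j • Finsupp.single (i, j + 1) 1 := by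
  rw [rightX, Finsupp.linearCombination_single, one_smul]

theorem rightW_single {k : Type*} [Field k] (i j : ℕ) :
    rightW k (Finsupp.single (i, j) 1) = Finsupp.single (i, j + 1) 1 := by
  rw [rightW, Finsupp.linearCombination_single, one_smul]

theorem rightX_mul_rightW {k : Type*} [Field k] (q r : k) :
    rightX q r * rightW k = q • (rightW k * rightX q r) + r • rightW k ^ 2 := by
  refine Finsupp.lhom_ext' fun ⟨i, j⟩ => LinearMap.ext_ring ?_
  simp only [LinearMap.comp_apply, Finsupp.lsingle_apply, Module.End.mul_apply, pow_two,
    LinearMap.add_apply, LinearMap.smul_apply, rightX_single, rightW_single, map_add, map_smul,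
    commCoeff]
  module

theorem rightW_pow_rightX_pow {k : Type*} [Field k] (q r : k) (i j : ℕ) :
    (rightW k ^ j * rightX q r ^ i) (Finsupp.single (0, 0) 1) = Finsupp.single (i, j) 1 := by
  have hx : (rightX q r ^ i) (Finsupp.single (0, 0) 1) = Finsupp.single (i, 0) 1 := by
    induction i with
    | zero => simp
    | succ i ih => rw [pow_succ', Module.End.mul_apply, ih, rightX_single]; simp [commCoeff]
  rw [Module.End.mul_apply, hx]
  induction j with
  | zero => simp
  | succ j ih => rw [pow_succ', Module.End.mul_apply, ih, rightW_single]

theorem smul_relation_iff {k A : Type*} [Field k] [Ring A] [Algebra k A] {a b p : k}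
    (hp : p ^ 2 + (b - 1) * p + a = 0) (hp1 : p ≠ 1) (x z w : A) (hw : z = w + p • x) :
    z * x = a • x ^ 2 + b • (x * z) + (1 : k) • z ^ 2 ↔
      w * x = ((b + p) / (1 - p)) • (x * w) + (1 / (1 - p)) • w ^ 2 := by
  have h1 : 1 - p ≠ 0 := sub_ne_zero.2 hp1.symm
  have key : z * x - (a • x ^ 2 + b • (x * z) + (1 : k) • z ^ 2) =
      (1 - p) • (w * x - (((b + p) / (1 - p)) • (x * w) + (1 / (1 - p)) • w ^ 2)) := by
    have ha : a = -(p ^ 2 + (b - 1) * p) := by linear_combination hp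
    subst hw ha
    simp only [pow_two, add_mul, mul_add, smul_mul_assoc, mul_smul_comm]
    match_scalars <;> field_simp
    all_goals ring
  rw [← sub_eq_zero, key, smul_eq_zero_iff_right h1, sub_eq_zero]

theorem mul_ι_mem_degComp {k : Type*} [Field k] {n : ℕ} {y : FreeAlgebra k (Fin 2)}
    (hy : y ∈ degComp k n) (t : Fin 2) : y * FreeAlgebra.ι k t ∈ degComp k (n + 1) := by
  induction hy using Submodule.span_induction with
  | mem y hy =>
    obtain ⟨l, rfl, rfl⟩ := hy
    exact Submodule.subset_span ⟨l ++ [t], by simp, by simp⟩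
  | zero => simp
  | add y y' _ _ h h' => rw [add_mul]; exact add_mem h h'
  | smul c y _ h => rw [smul_mul_assoc]; exact Submodule.smul_mem _ _ h

theorem pow_mul_pow_mem_degComp {k : Type*} [Field k] (p : k) (i j : ℕ) :
    Xf k ^ i * (Zf k - p • Xf k) ^ j ∈ degComp k (i + j) := by
  induction j with
  | zero =>
    induction i with
    | zero => exact Submodule.subset_span ⟨[], by simp, by simp⟩
    | succ i ih =>
      rw [pow_zero, mul_one] at ih ⊢
      exact pow_succ (Xf k) i ▸ mul_ι_mem_degComp ih 0
  | succ j ih =>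
    rw [pow_succ, ← mul_assoc, mul_sub, mul_smul_comm]
    exact sub_mem (mul_ι_mem_degComp ih 1) (Submodule.smul_mem _ _ (mul_ι_mem_degComp ih 0))

/-- The span of the ordered monomials of degree `n` in `x` and `w`. -/
def orderedSpan (k : Type*) {A : Type*} [Field k] [Ring A] [Algebra k A] (x w : A) (n : ℕ) :
    Submodule k A :=
  Submodule.span k (Set.range fun i : Fin (n + 1) => x ^ (i : ℕ) * w ^ (n - i))

theorem pow_mul_pow_mem_orderedSpan (k : Type*) {A : Type*} [Field k] [Ring A] [Algebra k A]
    (x w : A) {i j n : ℕ} (h : i + j = n) : x ^ i * w ^ j ∈ orderedSpan k x w n :=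
  Submodule.subset_span ⟨⟨i, by omega⟩, by simp [← h]⟩

theorem orderedSpan_mul_mem {k A : Type*} [Field k] [Ring A] [Algebra k A] {q r : k} {x w : A}
    (h : w * x = q • (x * w) + r • w ^ 2) {n : ℕ} {y : A} (hy : y ∈ orderedSpan k x w n) :
    y * x ∈ orderedSpan k x w (n + 1) ∧ y * w ∈ orderedSpan k x w (n + 1) := by
  induction hy using Submodule.span_induction with
  | mem y hy =>
    obtain ⟨i, rfl⟩ := hy
    have hi := i.is_le
    constructor
    · rw [mul_assoc, pow_mul_of_mul_eq h, mul_add, mul_smul_comm, mul_smul_comm, ← mul_assoc,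
        ← pow_succ]
      exact add_mem
        (Submodule.smul_mem _ _ (pow_mul_pow_mem_orderedSpan k x w (by omega)))
        (Submodule.smul_mem _ _ (pow_mul_pow_mem_orderedSpan k x w (by omega)))
    · rw [mul_assoc, ← pow_succ]
      exact pow_mul_pow_mem_orderedSpan k x w (by omega)
  | zero => simp
  | add y y' _ _ h h' => simp only [add_mul]; exact ⟨add_mem h.1 h'.1, add_mem h.2 h'.2⟩
  | smul c y _ h =>
    simp only [smul_mul_assoc]
    exact ⟨Submodule.smul_mem _ _ h.1, Submodule.smul_mem _ _ h.2⟩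

theorem map_degComp_eq_orderedSpan {k A : Type*} [Field k] [Ring A] [Algebra k A] {p q r : k}
    (f : FreeAlgebra k (Fin 2) →ₐ[k] A)
    (h : f (Zf k - p • Xf k) * f (Xf k) =
      q • (f (Xf k) * f (Zf k - p • Xf k)) + r • f (Zf k - p • Xf k) ^ 2) (n : ℕ) :
    (degComp k n).map f.toLinearMap = orderedSpan k (f (Xf k)) (f (Zf k - p • Xf k)) n := by
  apply le_antisymm
  · rw [degComp, Submodule.map_span_le]
    rintro _ ⟨l, rfl, rfl⟩
    induction l using List.reverseRecOn with
    | nil => simpa using pow_mul_pow_mem_orderedSpan k (f (Xf k)) (f (Zf k - p • Xf k)) (add_zero 0)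
    | append_singleton l t ih =>
      rw [List.map_append, List.prod_append, List.length_append, AlgHom.toLinearMap_apply, map_mul,
        List.map_singleton, List.prod_singleton, List.length_singleton]
      have hm := orderedSpan_mul_mem h ih
      fin_cases t
      · exact hm.1
      · have hz : f (Zf k) = f (Zf k - p • Xf k) + p • f (Xf k) := by simp
        change _ * f (Zf k) ∈ _
        rw [hz, mul_add, mul_smul_comm]
        exact add_mem hm.2 (Submodule.smul_mem _ _ hm.1)
  · rw [orderedSpan, Submodule.span_le]
    rintro _ ⟨i, rfl⟩
    refine ⟨Xf k ^ (i : ℕ) * (Zf k - p • Xf k) ^ (n - i), ?_, by simp⟩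
    have := pow_mul_pow_mem_degComp p (i : ℕ) (n - i)
    rwa [Nat.add_sub_cancel' i.is_le] at this

theorem exists_root_ne_one {k : Type*} [Field k] [IsAlgClosed k] (a b : k)
    (hab : ¬(a = 1 ∧ b = -1)) : ∃ p : k, p ^ 2 + (b - 1) * p + a = 0 ∧ p ≠ 1 := by
  by_cases h : a + b = 0
  · refine ⟨a, by linear_combination a * h, fun ha => hab ⟨ha, by linear_combination h - ha⟩⟩
  · obtain ⟨p, hp⟩ := IsAlgClosed.exists_root
      (Polynomial.C 1 * Polynomial.X ^ 2 + Polynomial.C (b - 1) * Polynomial.X + Polynomial.C a)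
      (by rw [Polynomial.degree_quadratic one_ne_zero]; decide)
    have hp' : p ^ 2 + (b - 1) * p + a = 0 := by simpa [Polynomial.IsRoot] using hp
    exact ⟨p, hp', fun h1 => h (by subst h1; linear_combination hp')⟩

/-- The ordered monomials in `x` and `w = z - p x` are linearly independent in `C(a,b,1)`. -/
theorem linearIndependent_pow_mul_pow {k : Type*} [Field k] {a b p : k}
    (hp : p ^ 2 + (b - 1) * p + a = 0) (hp1 : p ≠ 1) :
    LinearIndependent k fun v : ℕ × ℕ =>
      RingQuot.mkAlgHom k (Crel k a b 1) (Xf k) ^ v.1 *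
        RingQuot.mkAlgHom k (Crel k a b 1) (Zf k - p • Xf k) ^ v.2 := by
  set X := MulOpposite.op (rightX ((b + p) / (1 - p)) (1 / (1 - p))) with hX
  set W := MulOpposite.op (rightW k) with hW
  let g : FreeAlgebra k (Fin 2) →ₐ[k] (Module.End k (ℕ × ℕ →₀ k))ᵐᵒᵖ :=
    FreeAlgebra.lift k ![X, W + p • X]
  have gX : g (Xf k) = X := by simp [g, Xf]
  have gZ : g (Zf k) = W + p • X := by simp [g, Zf]
  have hg : ∀ ⦃m n⦄, Crel k a b 1 m n → g m = g n := by
    rintro m n ⟨rfl, rfl⟩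
    simp only [map_add, map_smul, map_mul, map_pow]
    refine (smul_relation_iff hp hp1 _ _ W (by rw [gX, gZ])).2 ?_
    rw [gX, hX, hW, ← MulOpposite.op_mul, rightX_mul_rightW]
    simp
  let φ := RingQuot.liftAlgHom k ⟨g, hg⟩
  have φm : ∀ y, φ (RingQuot.mkAlgHom k (Crel k a b 1) y) = g y :=
    RingQuot.liftAlgHom_mkAlgHom_apply k g hg
  let ψ : Calg k a b 1 →ₗ[k] (ℕ × ℕ →₀ k) :=
    LinearMap.applyₗ (Finsupp.single (0, 0) 1) ∘ₗ
      (MulOpposite.opLinearEquiv k).symm.toLinearMap ∘ₗ φ.toLinearMap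
  refine LinearIndependent.of_comp ψ ?_
  convert (Finsupp.basisSingleOne (R := k) (ι := ℕ × ℕ)).linearIndependent using 1
  funext ⟨i, j⟩
  have : ψ (RingQuot.mkAlgHom k (Crel k a b 1) (Xf k) ^ i *
        RingQuot.mkAlgHom k (Crel k a b 1) (Zf k - p • Xf k) ^ j) =
      MulOpposite.unop (X ^ i * W ^ j) (Finsupp.single (0, 0) 1) := by
    have gW : g (Zf k - p • Xf k) = W := by
      rw [map_sub, map_smul, gX, gZ]
      exact add_sub_cancel_right W (p • X)
    rw [← gX, ← gW, ← φm, ← φm, ← map_pow φ, ← map_pow φ, ← map_mul φ]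
    rfl
  rw [Function.comp_apply, this, Finsupp.coe_basisSingleOne]
  rw [MulOpposite.unop_mul, MulOpposite.unop_pow, MulOpposite.unop_pow]
  exact rightW_pow_rightX_pow _ _ i j

/-- If not both `a = 1` and `b = -1`, then the image in `C(a,b,1)` of the `n`-th homogeneous
component of `k⟨x,z⟩` has dimension `n + 1`; i.e. the Hilbert series of `C(a,b,1)` is
`(1-t)^{-2}`. -/
theorem stmt3 {k : Type*} [Field k] [IsAlgClosed k] (a b : k) (hab : ¬(a = 1 ∧ b = -1)) :
    ∀ n : ℕ,
      Module.finrank k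
        ((degComp k n).map (RingQuot.mkAlgHom k (Crel k a b 1)).toLinearMap) = n + 1 := by
  intro n
  obtain ⟨p, hp, hp1⟩ := exists_root_ne_one a b hab
  have hrel := RingQuot.mkAlgHom_rel k (s := Crel k a b 1) ⟨rfl, rfl⟩
  simp only [map_add, map_smul, map_mul, map_pow] at hrel
  rw [map_degComp_eq_orderedSpan (p := p) _
    ((smul_relation_iff hp hp1 _ _ _ (by simp)).1 hrel), orderedSpan, finrank_span_eq_card,
    Fintype.card_fin]
  exact (linearIndependent_pow_mul_pow hp hp1).comp (fun i : Fin (n + 1) => ((i : ℕ), n - i))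
    fun i j hij => Fin.ext (Prod.ext_iff.1 hij).1
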